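/- For every pair of non-negative integers n and m, MO(17m+16; 17n+15) ≡ 0 (mod 17). -/

import Mathlib

open Finset

/-- `MO a n` is MacMahon's coefficient: the sum of the products `s_1 ⋯ s_a` over all
strictly increasing tuples `0 < k_1 < ⋯ < k_a` of positive integers and positive
integers `s_1, …, s_a` with `s_1*k_1 + ⋯ + s_a*k_a = n` (all such data satisfy
`k_i, s_i ≤ n`, so we may sum over a finite set); in particular `MO a 0 = 0` for `a ≥ 1`. -/
def MO (a n : ℕ) : ℕ :=
  ∑ f ∈ Finset.univ.filter (fun f : Fin a → Fin (n + 1) × Fin (n + 1) =>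
      (∀ i, 0 < ((f i).1 : ℕ) ∧ 0 < ((f i).2 : ℕ)) ∧
      (∀ i j : Fin a, i < j → (f i).1 < (f j).1) ∧
      (∑ i, ((f i).2 : ℕ) * ((f i).1 : ℕ)) = n),
    ∏ i, ((f i).2 : ℕ)

lemma bernoulli_values : bernoulli 4 = -1 / 30 ∧ bernoulli 6 = 1 / 42 ∧
    bernoulli 16 = -3617 / 510 ∧ bernoulli 18 = 43867 / 798 := by
  have odd (n : ℕ) (h : Odd n) (h1 : 1 < n) : bernoulli n = 0 := bernoulli_eq_zero_of_odd h h1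
  have h2 : bernoulli 2 = 6⁻¹ := bernoulli_two
  have h4 := sum_bernoulli 5
  have h6 := sum_bernoulli 7
  have h8 := sum_bernoulli 9
  have h10 := sum_bernoulli 11
  have h12 := sum_bernoulli 13
  have h14 := sum_bernoulli 15
  have h16 := sum_bernoulli 17
  have h18 := sum_bernoulli 19
  simp only [Finset.sum_range_succ, Finset.sum_range_zero, bernoulli_zero, bernoulli_one, h2,
    odd 3 (by decide) (by decide), odd 5 (by decide) (by decide), odd 7 (by decide) (by decide),
    odd 9 (by decide) (by decide), odd 11 (by decide) (by decide), odd 13 (by decide) (by decide),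
    odd 15 (by decide) (by decide), odd 17 (by decide) (by decide)] at h4 h6 h8 h10 h12 h14 h16 h18
  norm_num [Nat.choose] at h4 h6 h8 h10 h12 h14 h16 h18
  refine ⟨?_, ?_, ?_, ?_⟩ <;> linarith

section ModularForms

open UpperHalfPlane ModularForm ModularFormClass MatrixGroups EisensteinSeries PowerSeries
open scoped ArithmeticFunction.sigma

/-- The integral power series `∑ σ_k(n) X^n`. -/
noncomputable def sigmaSeries (k : ℕ) : ℤ⟦X⟧ := PowerSeries.mk fun n ↦ (σ k n : ℤ)

lemma constantCoeff_sigmaSeries (k : ℕ) : constantCoeff (sigmaSeries k) = 0 := by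
  rw [← coeff_zero_eq_constantCoeff_apply]
  simp [sigmaSeries, -coeff_zero_eq_constantCoeff]

/-- The `q`-expansion of `E₄`. -/
noncomputable def seriesQ : ℤ⟦X⟧ := 1 + 240 * sigmaSeries 3

/-- The `q`-expansion of `E₆`. -/
noncomputable def seriesR : ℤ⟦X⟧ := 1 - 504 * sigmaSeries 5

lemma smul_qExpansion_E {k : ℕ} (hk : 3 ≤ k) (hk2 : Even k) (a b : ℤ)
    (hab : (a * (2 * k / bernoulli k) : ℚ) = b) :
    (a : ℂ) • qExpansion 1 (E hk) =
      PowerSeries.map (Int.castRingHom ℂ) (C a - C b * sigmaSeries (k - 1)) := by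
  have hab' : (a * (2 * k / (bernoulli k : ℂ)) : ℂ) = b := by exact_mod_cast hab
  ext n
  rw [PowerSeries.coeff_smul, E_qExpansion_coeff hk hk2, PowerSeries.coeff_map, map_sub,
    coeff_C_mul, coeff_C]
  by_cases h : n = 0
  · simp [h, constantCoeff_sigmaSeries]
  · simp [h, sigmaSeries, ← hab']
    ring

lemma qExpansion_E₄ : qExpansion 1 E₄ = PowerSeries.map (Int.castRingHom ℂ) seriesQ := by
  have := smul_qExpansion_E (k := 4) (by norm_num) ⟨2, rfl⟩ 1 (-240)
    (by rw [bernoulli_values.1]; norm_num)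
  simpa [seriesQ] using this

lemma qExpansion_E₆ : qExpansion 1 E₆ = PowerSeries.map (Int.castRingHom ℂ) seriesR := by
  have := smul_qExpansion_E (k := 6) (by norm_num) ⟨3, rfl⟩ 1 504
    (by rw [bernoulli_values.2.1]; norm_num)
  simpa [seriesR] using this

/-- An integral power series is a level one `q`-expansion of weight `k` if it is the `q`-expansion
of a modular form of weight `k` for `SL(2, ℤ)`. -/
def IsLevelOneQExpansion (k : ℕ) (g : ℤ⟦X⟧) : Prop :=
  ∃ f : ModularForm 𝒮ℒ (k : ℤ), qExpansion 1 f = PowerSeries.map (Int.castRingHom ℂ) g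

namespace IsLevelOneQExpansion

variable {k l : ℕ} {g h : ℤ⟦X⟧}

lemma mul (hg : IsLevelOneQExpansion k g) (hh : IsLevelOneQExpansion l h) :
    IsLevelOneQExpansion (k + l) (g * h) := by
  obtain ⟨f, hf⟩ := hg
  obtain ⟨f', hf'⟩ := hh
  refine ⟨mcast (by push_cast; rfl) (f.mul f'), ?_⟩
  rw [coe_mcast, ModularForm.qExpansion_mul one_pos one_mem_strictPeriods_SL, hf, hf', map_mul]

lemma sub (hg : IsLevelOneQExpansion k g) (hh : IsLevelOneQExpansion k h) :
    IsLevelOneQExpansion k (g - h) := by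
  obtain ⟨f, hf⟩ := hg
  obtain ⟨f', hf'⟩ := hh
  refine ⟨f - f', ?_⟩
  rw [FunLike.coe_sub, ModularForm.qExpansion_sub one_pos one_mem_strictPeriods_SL, hf, hf',
    map_sub]

lemma const_mul (hg : IsLevelOneQExpansion k g) (a : ℤ) : IsLevelOneQExpansion k (C a * g) := by
  obtain ⟨f, hf⟩ := hg
  refine ⟨(a : ℂ) • f, ?_⟩
  rw [FunLike.coe_smul, ModularForm.qExpansion_smul one_pos one_mem_strictPeriods_SL, hf, map_mul]
  simp [PowerSeries.smul_eq_C_mul]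

/-- The Sturm bound. -/
lemma eq_zero (hg : IsLevelOneQExpansion k g) (h0 : ∀ i ≤ k / 12, coeff i g = 0) : g = 0 := by
  obtain ⟨f, hf⟩ := hg
  have : f = 0 := by
    apply sturm_bound_levelOne_nat
    refine lt_of_lt_of_le ?_ (PowerSeries.nat_le_order _ (k / 12 + 1) fun i hi ↦ ?_)
    · exact_mod_cast Nat.lt_succ_self _
    · simp [hf, h0 i (by omega)]
  apply PowerSeries.map_injective (Int.castRingHom ℂ) Int.cast_injective
  rw [← hf, this, map_zero]
  simp [qExpansion_zero]

lemma eisenstein (hk : 3 ≤ k) (hk2 : Even k) (a b : ℤ)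
    (hab : (a * (2 * k / bernoulli k) : ℚ) = b) :
    IsLevelOneQExpansion k (C a - C b * sigmaSeries (k - 1)) :=
  ⟨(a : ℂ) • E hk, by
    rw [FunLike.coe_smul, ModularForm.qExpansion_smul one_pos one_mem_strictPeriods_SL,
      smul_qExpansion_E hk hk2 a b hab]⟩

lemma seriesQ : IsLevelOneQExpansion 4 seriesQ := ⟨E₄, qExpansion_E₄⟩

lemma seriesR : IsLevelOneQExpansion 6 seriesR := ⟨E₆, qExpansion_E₆⟩

end IsLevelOneQExpansion

lemma coeff_one_sigmaSeries (k : ℕ) : coeff 1 (sigmaSeries k) = 1 := by simp [sigmaSeries]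

lemma coeff_one_seriesQ : coeff 1 seriesQ = 240 := by
  rw [seriesQ, show (240 : ℤ⟦X⟧) = C 240 by simp, map_add, coeff_C_mul, coeff_one_sigmaSeries]
  simp [coeff_one]

lemma coeff_one_seriesR : coeff 1 seriesR = -504 := by
  rw [seriesR, show (504 : ℤ⟦X⟧) = C 504 by simp, map_sub, coeff_C_mul, coeff_one_sigmaSeries]
  simp [coeff_one]

lemma constantCoeff_seriesQ : constantCoeff seriesQ = 1 := by
  simp [seriesQ, constantCoeff_sigmaSeries]

lemma constantCoeff_seriesR : constantCoeff seriesR = 1 := by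
  simp [seriesR, constantCoeff_sigmaSeries]

lemma eisenstein_sixteen :
    3617 + 16320 * sigmaSeries 15 = 1617 * seriesQ ^ 4 + 2000 * (seriesQ * seriesR ^ 2) := by
  have hQ := IsLevelOneQExpansion.seriesQ
  have hR := IsLevelOneQExpansion.seriesR
  have h := (((IsLevelOneQExpansion.eisenstein (k := 16) (by norm_num) (by decide) 3617 (-16320)
    (by rw [bernoulli_values.2.2.1]; norm_num)).sub
    ((((hQ.mul hQ).mul hQ).mul hQ).const_mul 1617)).sub
    (((hQ.mul hR).mul hR).const_mul 2000)).eq_zero fun i hi ↦ by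
      interval_cases i
      · simp [constantCoeff_seriesQ, constantCoeff_seriesR, constantCoeff_sigmaSeries,
          -eq_intCast]
      · simp only [map_sub, coeff_C_mul, coeff_one_mul, coeff_one_seriesQ, coeff_one_seriesR,
          coeff_one_sigmaSeries, constantCoeff_seriesQ, constantCoeff_seriesR, map_mul, coeff_C]
        norm_num
  simp only [map_neg, map_ofNat] at h
  linear_combination h

lemma eisenstein_eighteen :
    43867 - 28728 * sigmaSeries 17 = 38367 * (seriesQ ^ 3 * seriesR) + 5500 * seriesR ^ 3 := by
  have hQ := IsLevelOneQExpansion.seriesQ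
  have hR := IsLevelOneQExpansion.seriesR
  have h := (((IsLevelOneQExpansion.eisenstein (k := 18) (by norm_num) (by decide) 43867 28728
    (by rw [bernoulli_values.2.2.2]; norm_num)).sub
    ((((hQ.mul hQ).mul hQ).mul hR).const_mul 38367)).sub
    (((hR.mul hR).mul hR).const_mul 5500)).eq_zero fun i hi ↦ by
      interval_cases i
      · simp [constantCoeff_seriesQ, constantCoeff_seriesR, constantCoeff_sigmaSeries,
          -eq_intCast]
      · simp only [map_sub, coeff_C_mul, coeff_one_mul, coeff_one_seriesQ, coeff_one_seriesR,
          coeff_one_sigmaSeries, constantCoeff_seriesQ, constantCoeff_seriesR, map_mul, coeff_C]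
        norm_num
  simp only [map_ofNat] at h
  linear_combination h

end ModularForms

section EulerProduct

open PowerSeries

variable (R : Type*) [CommRing R]

/-- The polynomial `∏_{k ≤ N} (1 - X^k)`, as a power series. -/
noncomputable def eulerPartial (N : ℕ) : R⟦X⟧ := ∏ i ∈ range N, (1 - X ^ (i + 1))

/-- Euler's product `∏ (1 - X^k)`. -/
noncomputable def eulerSeries : R⟦X⟧ := PowerSeries.mk fun n ↦ coeff n (eulerPartial R n)

variable {R}

lemma eulerPartial_succ (N : ℕ) :
    eulerPartial R (N + 1) = eulerPartial R N * (1 - X ^ (N + 1)) := prod_range_succ _ _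

lemma dvd_eulerPartial_sub (n k : ℕ) :
    (X : R⟦X⟧) ^ (n + 1) ∣ eulerPartial R (n + k) - eulerPartial R n := by
  induction k with
  | zero => simp
  | succ k ih =>
    have : (X : R⟦X⟧) ^ (n + 1) ∣ X ^ (n + k + 1) := pow_dvd_pow _ (by omega)
    rw [← add_assoc, eulerPartial_succ]
    convert ih.sub (this.mul_left (eulerPartial R (n + k))) using 1
    ring

lemma dvd_eulerSeries_sub {n N : ℕ} (h : n ≤ N) :
    (X : R⟦X⟧) ^ (n + 1) ∣ eulerSeries R - eulerPartial R N := by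
  rw [X_pow_dvd_iff]
  intro m hm
  obtain ⟨k, rfl⟩ := Nat.exists_eq_add_of_le (show m ≤ N by omega)
  have := X_pow_dvd_iff.mp (dvd_eulerPartial_sub (R := R) m k) m (by omega)
  rw [map_sub, sub_eq_zero] at this ⊢
  rw [this, eulerSeries, coeff_mk]

lemma map_eulerPartial {S : Type*} [CommRing S] (f : R →+* S) (N : ℕ) :
    PowerSeries.map f (eulerPartial R N) = eulerPartial S N := by
  simp [eulerPartial]

lemma map_eulerSeries {S : Type*} [CommRing S] (f : R →+* S) :
    PowerSeries.map f (eulerSeries R) = eulerSeries S := by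
  ext n
  rw [coeff_map, eulerSeries, coeff_mk, ← coeff_map, map_eulerPartial, eulerSeries, coeff_mk]

lemma constantCoeff_eulerSeries : constantCoeff (eulerSeries R) = 1 := by
  rw [← coeff_zero_eq_constantCoeff_apply]
  simp [eulerSeries, eulerPartial, -coeff_zero_eq_constantCoeff]

end EulerProduct

section Discriminant

open PowerSeries Filter Topology UpperHalfPlane ModularForm ModularFormClass MatrixGroups
  EisensteinSeries

lemma TendstoLocallyUniformlyOn.pow_of_continuousOn {ι : Type*} {l : Filter ι}
    {F : ι → ℂ → ℂ} {f : ℂ → ℂ} {s : Set ℂ} (h : TendstoLocallyUniformlyOn F f l s)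
    (hf : ContinuousOn f s) (n : ℕ) :
    TendstoLocallyUniformlyOn (fun i ↦ F i ^ n) (f ^ n) l s := by
  induction n with
  | zero =>
    simp only [pow_zero]
    exact fun u hu x hx ↦ ⟨Set.univ, univ_mem, .of_forall fun i y _ ↦ refl_mem_uniformity hu⟩
  | succ n ih => simpa only [pow_succ] using! ih.mul₀ h (hf.pow n) hf

/-- The polynomial `X ∏_{k ≤ N} (1 - X^k)^24`. -/
noncomputable def discriminantPartial (N : ℕ) : Polynomial ℂ :=
  Polynomial.X * (∏ i ∈ range N, (1 - Polynomial.X ^ (i + 1))) ^ 24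

lemma tendsto_discriminantPartial :
    TendstoLocallyUniformlyOn (fun N q ↦ (discriminantPartial N).eval q)
      (cuspFunction 1 ModularForm.discriminant) atTop (Metric.ball 0 1) := by
  have hT := multipliableLocallyUniformlyOn_one_sub_pow.hasProdLocallyUniformlyOn
    |>.tendstoLocallyUniformlyOn_finsetRange
  have hc := differentiableOn_tprod_one_sub_pow.continuousOn
  have hid : TendstoLocallyUniformlyOn (fun (_ : ℕ) (q : ℂ) ↦ q) (fun q ↦ q) atTop
      (Metric.ball 0 1) :=
    fun u hu x hx ↦ ⟨Set.univ, univ_mem, .of_forall fun i y _ ↦ refl_mem_uniformity hu⟩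
  have := hid.mul₀ (hT.pow_of_continuousOn hc 24) continuousOn_id (hc.pow 24)
  refine (this.congr_right fun q hq ↦ ?_).congr fun N q hq ↦ ?_
  · rw [discriminant_cuspFunction_eqOn hq]
    simp [(multipliable_one_sub_pow (by simpa using hq)).tprod_pow]
  · simp [discriminantPartial, Polynomial.eval_prod]

lemma tendsto_iterate_derivative_discriminantPartial (j : ℕ) :
    TendstoLocallyUniformlyOn
      (fun N q ↦ ((Polynomial.derivative^[j] (discriminantPartial N)).eval q))
      (iteratedDeriv j (cuspFunction 1 ModularForm.discriminant)) atTop (Metric.ball 0 1) := by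
  induction j with
  | zero => simpa using tendsto_discriminantPartial
  | succ j ih =>
    rw [iteratedDeriv_succ]
    refine (ih.deriv (.of_forall fun N ↦ by fun_prop) Metric.isOpen_ball).congr fun N q hq ↦ ?_
    simp [Function.iterate_succ_apply', -Function.iterate_succ]

lemma coeff_discriminantPartial {j N : ℕ} (h : j ≤ N) :
    (discriminantPartial N).coeff j = coeff j (X * eulerSeries ℂ ^ 24) := by
  have hd : (X : ℂ⟦X⟧) ^ (N + 1) ∣ X * eulerSeries ℂ ^ 24 - X * eulerPartial ℂ N ^ 24 := by
    rw [← mul_sub]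
    exact ((dvd_eulerSeries_sub le_rfl).trans (sub_dvd_pow_sub_pow _ _ _)).mul_left _
  have := X_pow_dvd_iff.mp hd j (by omega)
  rw [map_sub, sub_eq_zero] at this
  rw [this, ← Polynomial.coeff_coe]
  congr 1
  simp only [discriminantPartial, eulerPartial, Polynomial.coe_mul, Polynomial.coe_pow,
    Polynomial.coe_X]
  congr 2
  rw [← Polynomial.coeToPowerSeries.ringHom_apply, map_prod]
  simp

lemma qExpansion_discriminant : qExpansion 1 ModularForm.discriminant = X * eulerSeries ℂ ^ 24 := by
  ext j
  have h0 : (0 : ℂ) ∈ Metric.ball (0 : ℂ) 1 := by simp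
  have h1 := (tendsto_iterate_derivative_discriminantPartial j).tendsto_at h0
  have h2 : Tendsto (fun N ↦ ((Polynomial.derivative^[j] (discriminantPartial N)).eval 0)) atTop
      (𝓝 (j.factorial * coeff j (X * eulerSeries ℂ ^ 24))) := by
    refine tendsto_const_nhds.congr' ?_
    filter_upwards [eventually_ge_atTop j] with N hN
    rw [← coeff_discriminantPartial hN, ← Polynomial.coeff_zero_eq_eval_zero,
      Polynomial.coeff_iterate_derivative]
    simp [Nat.descFactorial_self]
  rw [qExpansion_coeff, tendsto_nhds_unique h1 h2]
  exact inv_mul_cancel_left₀ (by exact_mod_cast j.factorial_ne_zero) _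

lemma seriesQ_cube_sub_seriesR_sq :
    seriesQ ^ 3 - seriesR ^ 2 = 1728 * (X * eulerSeries ℤ ^ 24) := by
  apply PowerSeries.map_injective (Int.castRingHom ℂ) Int.cast_injective
  have hE : (1728 : ℂ) • ModularForm.discriminant = ⇑(E₄.mul (E₄.mul E₄)) - ⇑(E₆.mul E₆) := by
    ext z
    change 1728 * ModularForm.discriminant z = E₄ z * (E₄ z * E₄ z) - E₆ z * E₆ z
    rw [discriminant_eq_E₄_cube_sub_E₆_sq]
    ring
  have ha {k : ℤ} (f : ModularForm 𝒮ℒ k) : AnalyticAt ℂ (cuspFunction 1 f) 0 :=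
    ModularFormClass.analyticAt_cuspFunction_zero f one_pos one_mem_strictPeriods_SL
  have hD : AnalyticAt ℂ (cuspFunction 1 ModularForm.discriminant) 0 :=
    ModularFormClass.analyticAt_cuspFunction_zero CuspForm.discriminant one_pos
      one_mem_strictPeriods_SL
  have := congrArg (qExpansion 1) hE
  rw [qExpansion_smul hD, qExpansion_sub (ha _) (ha _), qExpansion_discriminant,
    ModularForm.qExpansion_mul one_pos one_mem_strictPeriods_SL,
    ModularForm.qExpansion_mul one_pos one_mem_strictPeriods_SL,
    ModularForm.qExpansion_mul one_pos one_mem_strictPeriods_SL, qExpansion_E₄,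
    qExpansion_E₆] at this
  simp only [map_sub, map_mul, map_pow, map_eulerSeries, map_X, map_ofNat]
  rw [PowerSeries.smul_eq_C_mul, map_ofNat] at this
  linear_combination -this

end Discriminant

section Ramanujan

/-- In characteristic `17`, Ramanujan's relations between `P`, `Q`, `R` and a constant `Q`-multiple
force `(Q ^ 3 - R ^ 2) ^ 2` to be a derivative. -/
lemma exists_derivation_eq_sq {k A : Type*} [CommRing k] [CommRing A] [IsDomain A] [Algebra k A]
    (h17 : (17 : A) = 0) (θ : Derivation k A A) {P Q R : A} (hA : 2 * Q ^ 4 + 11 * (Q * R ^ 2) = 13)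
    (hP : P = R * (7 * Q ^ 3 + 11 * R ^ 2)) (hD : θ (Q ^ 3 - R ^ 2) = P * (Q ^ 3 - R ^ 2))
    (hR : R ≠ 0) (h0 : 7 * Q ^ 3 + 11 * R ^ 2 ≠ 0) :
    ∃ G, θ G = (Q ^ 3 - R ^ 2) ^ 2 := by
  have hnum (n : ℕ) : θ (n : A) = 0 := θ.map_natCast n
  have hA' : (8 * Q ^ 3 + 11 * R ^ 2) * θ Q + 22 * (Q * R) * θ R = 0 := by
    have := congrArg θ hA
    simp only [map_add, Derivation.leibniz, Derivation.leibniz_pow, smul_eq_mul, nsmul_eq_mul,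
      ← Nat.cast_ofNat (R := A), hnum] at this
    push_cast at this
    linear_combination this
  have hD' : 3 * Q ^ 2 * θ Q - 2 * R * θ R = P * (Q ^ 3 - R ^ 2) := by
    rw [← hD]
    simp only [map_sub, Derivation.leibniz_pow, smul_eq_mul, nsmul_eq_mul]
    push_cast
    ring
  have hQ : θ Q = 11 * (Q * R) * (Q ^ 3 - R ^ 2) := by
    apply mul_left_cancel₀ h0
    linear_combination hA' + 11 * Q * hD' - 2 * Q ^ 3 * θ Q * h17 +
      11 * Q * (Q ^ 3 - R ^ 2) * hP
  have hR : θ R = (Q ^ 3 - R ^ 2) * (13 * Q ^ 3 + 3 * R ^ 2) := by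
    apply mul_left_cancel₀ hR
    linear_combination -9 * hD' + 27 * Q ^ 2 * hQ - 9 * (Q ^ 3 - R ^ 2) * hP - R * θ R * h17 +
      R * (Q ^ 3 - R ^ 2) * (13 * Q ^ 3 - 6 * R ^ 2) * h17
  refine ⟨((9 : ℕ) : A) * (((15 : ℕ) : A) * (Q ^ 24 * R) + ((5 : ℕ) : A) * (Q ^ 21 * R ^ 3) +
    ((9 : ℕ) : A) * (Q ^ 18 * R ^ 5) + ((13 : ℕ) : A) * (Q ^ 15 * R ^ 7) +
    ((3 : ℕ) : A) * (Q ^ 12 * R ^ 9) + ((5 : ℕ) : A) * (Q ^ 9 * R ^ 11) +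
    ((11 : ℕ) : A) * (Q ^ 6 * R ^ 13)), ?_⟩
  have hA6 : (2 * Q ^ 4 + 11 * (Q * R ^ 2)) ^ 6 = 13 ^ 6 := by rw [hA]
  simp only [map_add, Derivation.leibniz, Derivation.leibniz_pow, smul_eq_mul, nsmul_eq_mul, hnum,
    hQ, hR]
  push_cast
  linear_combination 135 * (Q ^ 3 - R ^ 2) ^ 2 * hA6 + 9 * (Q ^ 3 - R ^ 2) * (-45 * Q ^ 27 -
    1560 * Q ^ 24 * R ^ 2 - 23655 * Q ^ 21 * R ^ 4 - 162100 * Q ^ 18 * R ^ 6 -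
    587043 * Q ^ 15 * R ^ 8 - 930064 * Q ^ 12 * R ^ 10 + 142252 * Q ^ 9 * R ^ 12 +
    1563210 * Q ^ 6 * R ^ 14) * h17 + 38330542 * (Q ^ 3 - R ^ 2) ^ 2 * h17

end Ramanujan

section Theta

open PowerSeries
open scoped ArithmeticFunction.sigma

variable {R : Type*} [CommRing R]

variable (R) in
/-- The derivation `X d/dX` of a power series ring. -/
noncomputable def theta : Derivation R R⟦X⟧ R⟦X⟧ := (X : R⟦X⟧) • d⁄dX R

lemma coeff_theta (f : R⟦X⟧) (n : ℕ) : coeff n (theta R f) = n * coeff n f := by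
  change coeff n (X * d⁄dX R f) = _
  cases n with
  | zero => simp
  | succ n => rw [coeff_succ_X_mul, coeff_derivative]; push_cast; ring

lemma theta_X_pow (n : ℕ) : theta R (X ^ n) = (n : R⟦X⟧) * X ^ n := by
  ext m
  rw [coeff_theta, ← map_natCast (C : R →+* R⟦X⟧), coeff_C_mul, coeff_X_pow]
  split_ifs with h <;> simp [h]

lemma dvd_theta {f : R⟦X⟧} {n : ℕ} (h : X ^ n ∣ f) : X ^ n ∣ theta R f := by
  rw [X_pow_dvd_iff] at h ⊢
  intro m hm
  rw [coeff_theta, h m hm, mul_zero]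

/-- The power series `∑_{s ≥ 1} X ^ (k s)`. -/
noncomputable def multiplesSeries (R : Type*) [CommRing R] (k : ℕ) : R⟦X⟧ :=
  PowerSeries.mk fun n ↦ if k ∣ n ∧ n ≠ 0 then 1 else 0

lemma one_sub_mul_multiplesSeries {k : ℕ} (hk : k ≠ 0) :
    (1 - X ^ k) * multiplesSeries R k = X ^ k := by
  ext n
  rw [sub_mul, one_mul, map_sub, coeff_X_pow_mul', coeff_X_pow]
  simp only [multiplesSeries, coeff_mk]
  rcases lt_trichotomy n k with h | rfl | h
  · have : ¬ (k ∣ n ∧ n ≠ 0) := fun ⟨h1, h2⟩ ↦ h2 (Nat.eq_zero_of_dvd_of_lt h1 h)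
    rw [if_neg this, if_neg (by omega), if_neg (by omega), sub_zero]
  · simp [hk]
  · have : k ∣ n - k ↔ k ∣ n := by rw [Nat.dvd_sub_self_right]; omega
    simp [h.le, this, h.ne', show n ≠ 0 by omega, show n - k ≠ 0 by omega]

/-- The power series `∑ σ_1(n) X^n`. -/
noncomputable def sigmaOneSeries (R : Type*) [CommRing R] : R⟦X⟧ :=
  PowerSeries.mk fun n ↦ (σ 1 n : R)

lemma dvd_sigmaOneSeries_sub (N : ℕ) :
    X ^ (N + 1) ∣ sigmaOneSeries R -
      ∑ i ∈ range N, ((i + 1 : ℕ) : R⟦X⟧) * multiplesSeries R (i + 1) := by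
  rw [X_pow_dvd_iff]
  intro m hm
  rw [map_sub, map_sum, sub_eq_zero]
  simp only [← map_natCast (C : R →+* R⟦X⟧), coeff_C_mul, multiplesSeries, sigmaOneSeries, coeff_mk,
    ArithmeticFunction.sigma_one_apply]
  rcases eq_or_ne m 0 with rfl | hm0
  · simp
  · simp only [ne_eq, hm0, not_false_eq_true, and_true, mul_ite, mul_one, mul_zero, Nat.cast_sum]
    rw [sum_ite, sum_const_zero, add_zero]
    refine sum_bij' (fun d _ ↦ d - 1) (fun i _ ↦ i + 1) ?_ ?_ ?_ ?_ ?_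
    · intro d hd
      have := Nat.pos_of_mem_divisors hd
      have := Nat.divisor_le hd
      simp only [mem_filter, mem_range]
      refine ⟨by omega, ?_⟩
      rw [Nat.sub_add_cancel (by omega)]
      exact Nat.dvd_of_mem_divisors hd
    · intro i hi
      simp only [mem_filter] at hi
      exact Nat.mem_divisors.mpr ⟨hi.2, hm0⟩
    · intro d hd
      exact Nat.sub_add_cancel (Nat.pos_of_mem_divisors hd)
    · intro i _; simp
    · intro d hd
      rw [Nat.sub_add_cancel (Nat.pos_of_mem_divisors hd)]

lemma theta_eulerPartial (N : ℕ) :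
    theta R (eulerPartial R N) =
      - (eulerPartial R N * ∑ i ∈ range N, ((i + 1 : ℕ) : R⟦X⟧) * multiplesSeries R (i + 1)) := by
  induction N with
  | zero => simp [eulerPartial]
  | succ N ih =>
    rw [eulerPartial_succ, Derivation.leibniz, ih, map_sub, theta_X_pow, sum_range_succ,
      Derivation.map_one_eq_zero, smul_eq_mul, smul_eq_mul]
    linear_combination eulerPartial R N * ((N + 1 : ℕ) : R⟦X⟧) *
      one_sub_mul_multiplesSeries (R := R) (N.add_one_ne_zero)

lemma eq_of_forall_dvd_sub {f g : R⟦X⟧} (h : ∀ n : ℕ, X ^ (n + 1) ∣ f - g) : f = g := by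
  ext n
  have := X_pow_dvd_iff.mp (h n) n (by omega)
  rwa [map_sub, sub_eq_zero] at this

lemma theta_eulerSeries :
    theta R (eulerSeries R) = - (eulerSeries R * sigmaOneSeries R) := by
  refine eq_of_forall_dvd_sub fun n ↦ ?_
  have h1 := dvd_eulerSeries_sub (R := R) (le_refl n)
  have h2 := dvd_theta h1
  have h3 := dvd_sigmaOneSeries_sub (R := R) n
  rw [map_sub, theta_eulerPartial] at h2
  convert (h2.add (h1.mul_right (sigmaOneSeries R))).add (h3.mul_left (eulerPartial R n)) using 1
  ring

lemma theta_X_mul_eulerSeries_pow :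
    theta R (X * eulerSeries R ^ 24) =
      (1 - 24 * sigmaOneSeries R) * (X * eulerSeries R ^ 24) := by
  have hX : theta R X = X := by simpa using theta_X_pow (R := R) 1
  simp only [Derivation.leibniz, Derivation.leibniz_pow, theta_eulerSeries, hX, smul_eq_mul,
    nsmul_eq_mul]
  push_cast
  ring

end Theta

section ModSeventeen

open PowerSeries

instance : Fact (Nat.Prime 17) := ⟨by norm_num⟩

lemma seventeen_eq_zero : (17 : (ZMod 17)⟦X⟧) = 0 := by
  rw [← map_ofNat (C : ZMod 17 →+* (ZMod 17)⟦X⟧), show (OfNat.ofNat 17 : ZMod 17) = 0 from rfl,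
    map_zero]

lemma map_sigmaSeries_seventeen :
    PowerSeries.map (Int.castRingHom (ZMod 17)) (sigmaSeries 17) = sigmaOneSeries (ZMod 17) := by
  ext n
  simp [sigmaSeries, sigmaOneSeries, ArithmeticFunction.sigma_apply, ZMod.pow_card]

/-- The square of the reduction of the discriminant modulo `17` is a derivative. -/
lemma exists_theta_eq :
    ∃ G, theta (ZMod 17) G = X ^ 2 * eulerSeries (ZMod 17) ^ 48 := by
  set φ := PowerSeries.map (Int.castRingHom (ZMod 17))
  have h17 := seventeen_eq_zero
  have hA := congrArg φ eisenstein_sixteen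
  have hP := congrArg φ eisenstein_eighteen
  have hD := congrArg φ seriesQ_cube_sub_seriesR_sq
  simp only [map_add, map_sub, map_mul, map_pow, map_ofNat, φ, map_X, map_eulerSeries,
    map_sigmaSeries_seventeen] at hA hP hD
  have hQ0 : constantCoeff (φ seriesQ) = 1 := by
    rw [← coeff_zero_eq_constantCoeff_apply, coeff_map, coeff_zero_eq_constantCoeff_apply,
      constantCoeff_seriesQ, map_one]
  have hR0 : constantCoeff (φ seriesR) = 1 := by
    rw [← coeff_zero_eq_constantCoeff_apply, coeff_map, coeff_zero_eq_constantCoeff_apply,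
      constantCoeff_seriesR, map_one]
  have hA' : 2 * φ seriesQ ^ 4 + 11 * (φ seriesQ * φ seriesR ^ 2) = 13 := by
    linear_combination -hA + (960 * φ (sigmaSeries 15) + 212 - 95 * φ seriesQ ^ 4 -
      117 * φ seriesQ * φ seriesR ^ 2) * h17
  have hP' : 1 - 24 * sigmaOneSeries (ZMod 17) =
      φ seriesR * (7 * φ seriesQ ^ 3 + 11 * φ seriesR ^ 2) := by
    linear_combination 5 * hP + (-12902 + 8448 * sigmaOneSeries (ZMod 17) + 11284 * φ seriesQ ^ 3 *
      φ seriesR + 1617 * φ seriesR ^ 3) * h17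
  have hD' : theta (ZMod 17) (φ seriesQ ^ 3 - φ seriesR ^ 2) =
      (1 - 24 * sigmaOneSeries (ZMod 17)) * (φ seriesQ ^ 3 - φ seriesR ^ 2) := by
    rw [hD, Derivation.leibniz, theta_X_mul_eulerSeries_pow,
      ← Nat.cast_ofNat (R := (ZMod 17)⟦X⟧), Derivation.map_natCast]
    simp only [smul_eq_mul]
    ring
  have hR : φ seriesR ≠ 0 := fun h ↦ by simp [h] at hR0
  have h0 : 7 * φ seriesQ ^ 3 + 11 * φ seriesR ^ 2 ≠ 0 := fun h ↦ by
    have := congrArg constantCoeff h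
    simp only [map_add, map_mul, map_pow, hQ0, hR0, map_ofNat, map_zero] at this
    exact absurd this (by decide)
  obtain ⟨G, hG⟩ := exists_derivation_eq_sq h17 (theta (ZMod 17)) hA' hP' hD' hR h0
  refine ⟨((9 : ℕ) : (ZMod 17)⟦X⟧) * G, ?_⟩
  rw [Derivation.leibniz, Derivation.map_natCast, hG, hD]
  simp only [smul_eq_mul]
  push_cast
  linear_combination 1580815 * (X ^ 2 * eulerSeries (ZMod 17) ^ 48) * h17

end ModSeventeen

section TripleProduct

open PowerSeries

variable {R : Type*} [CommRing R]

/-- The polynomials with generating function `(1 + t) / ((1 - t) ^ 2 + x t)`. -/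
noncomputable def macMahonPoly (S : Type*) [CommRing S] : ℕ → Polynomial S
  | 0 => 1
  | 1 => 3 - Polynomial.X
  | j + 2 => (2 - Polynomial.X) * macMahonPoly S (j + 1) - macMahonPoly S j

lemma coeff_macMahonPoly (S : Type*) [CommRing S] (j a : ℕ) :
    (macMahonPoly S j).coeff a =
      (-1) ^ a * ((j + a + 1).choose (2 * a + 1) + (j + a).choose (2 * a + 1) : ℕ) := by
  induction j using Nat.twoStepInduction generalizing a with
  | zero =>
    rcases a with _ | a
    · simp [macMahonPoly]
    · rw [macMahonPoly, Polynomial.coeff_one, Nat.choose_eq_zero_of_lt (by omega),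
        Nat.choose_eq_zero_of_lt (by omega)]
      simp
  | one =>
    rcases a with _ | _ | a
    · simp [macMahonPoly]
    · simp [macMahonPoly, Polynomial.coeff_ofNat_succ]
    · rw [macMahonPoly, Polynomial.coeff_sub, Polynomial.coeff_X, Polynomial.coeff_ofNat_succ,
        Nat.choose_eq_zero_of_lt (by omega), Nat.choose_eq_zero_of_lt (by omega)]
      simp
  | more j ih0 ih1 =>
    rw [macMahonPoly, sub_mul, Polynomial.coeff_sub, Polynomial.coeff_sub, ih0,
      Polynomial.coeff_ofNat_mul, ih1]
    rcases a with _ | a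
    · simp
      ring
    · rw [Polynomial.coeff_X_mul, ih1]
      have h1 : (j + 2 + (a + 1) + 1).choose (2 * (a + 1) + 1) + (j + (a + 1) + 1).choose
          (2 * (a + 1) + 1) = 2 * (j + 1 + (a + 1) + 1).choose (2 * (a + 1) + 1) +
          (j + 1 + a + 1).choose (2 * a + 1) := by
        rw [show j + 2 + (a + 1) + 1 = (j + a + 2) + 1 + 1 by ring,
          show j + (a + 1) + 1 = j + a + 2 by ring,
          show j + 1 + (a + 1) + 1 = (j + a + 2) + 1 by ring,
          show j + 1 + a + 1 = j + a + 2 by ring, show 2 * (a + 1) + 1 = 2 * a + 1 + 1 + 1 by ring]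
        simp only [Nat.choose_succ_succ']
        ring
      have h2 : (j + 2 + (a + 1)).choose (2 * (a + 1) + 1) + (j + (a + 1)).choose
          (2 * (a + 1) + 1) = 2 * (j + 1 + (a + 1)).choose (2 * (a + 1) + 1) +
          (j + 1 + a).choose (2 * a + 1) := by
        rw [show j + 2 + (a + 1) = (j + a + 1) + 1 + 1 by ring,
          show j + (a + 1) = j + a + 1 by ring,
          show j + 1 + (a + 1) = (j + a + 1) + 1 by ring,
          show j + 1 + a = j + a + 1 by ring, show 2 * (a + 1) + 1 = 2 * a + 1 + 1 + 1 by ring]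
        simp only [Nat.choose_succ_succ']
        ring
      have h1' := congrArg (Nat.cast (R := S)) h1
      have h2' := congrArg (Nat.cast (R := S)) h2
      push_cast at h1' h2' ⊢
      linear_combination (-1) ^ a * (h1' + h2')

lemma mul_sum_macMahonPoly {S : Type*} [CommRing S] (Q : S) (c c' : ℕ → S)
    (h0 : c' 0 = (1 + Q ^ 2 + Q) * c 0 - Q * c 1)
    (h : ∀ j, c' (j + 1) = (1 + Q ^ 2) * c (j + 1) - Q * (c j + c (j + 2))) (M : ℕ) :
    (Polynomial.C ((1 - Q) ^ 2) + Polynomial.C Q * Polynomial.X) *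
        ∑ j ∈ range (M + 1), Polynomial.C (c j) * macMahonPoly S j =
      ∑ j ∈ range (M + 1), Polynomial.C (c' j) * macMahonPoly S j +
        Polynomial.C Q * (Polynomial.C (c (M + 1)) * macMahonPoly S M -
          Polynomial.C (c M) * macMahonPoly S (M + 1)) := by
  induction M with
  | zero =>
    simp only [zero_add, sum_range_one, h0, macMahonPoly, map_sub, map_mul, map_add, map_pow,
      map_one]
    ring
  | succ M ih =>
    rw [sum_range_succ, mul_add, ih, sum_range_succ _ (M + 1), h, macMahonPoly]
    simp only [map_sub, map_mul, map_add, map_pow, map_one]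
    ring

variable (R) in
/-- The inverse of `eulerPartial R N`. -/
noncomputable def eulerPartialInv (N : ℕ) : R⟦X⟧ := invOfUnit (eulerPartial R N) 1

lemma eulerPartial_mul_inv (N : ℕ) : eulerPartial R N * eulerPartialInv R N = 1 :=
  mul_invOfUnit _ _ (by simp [eulerPartial])

lemma eulerPartialInv_eq (N : ℕ) :
    eulerPartialInv R N = (1 - X ^ (N + 1)) * eulerPartialInv R (N + 1) := by
  have h := eulerPartial_mul_inv (R := R) (N + 1)
  rw [eulerPartial_succ] at h
  linear_combination (-eulerPartialInv R N) * h +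
    (1 - X ^ (N + 1)) * eulerPartialInv R (N + 1) * eulerPartial_mul_inv (R := R) N

variable (R) in
/-- The coefficients of the finite form of Jacobi's triple product. -/
noncomputable def tripleCoeff (N j : ℕ) : R⟦X⟧ :=
  if j ≤ N then (-1) ^ j * X ^ (j + 1).choose 2 * eulerPartial R (2 * N + 1) *
    (eulerPartialInv R (N - j) * eulerPartialInv R (N + j + 1)) else 0

lemma tripleCoeff_of_lt {N j : ℕ} (h : N < j) : tripleCoeff R N j = 0 := if_neg (by omega)

lemma tripleCoeff_add (d j : ℕ) :
    tripleCoeff R (j + d) j = (-1) ^ j * X ^ (j + 1).choose 2 * eulerPartial R (2 * (j + d) + 1) *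
      (eulerPartialInv R d * eulerPartialInv R (2 * j + d + 1)) := by
  rw [tripleCoeff, if_pos (by omega), Nat.add_sub_cancel_left]
  congr 3
  ring

lemma tripleCoeff_add_succ (d j : ℕ) :
    tripleCoeff R (j + d) (j + 1) = - ((-1) ^ j * X ^ ((j + 1).choose 2 + j + 1) * (1 - X ^ d) *
      eulerPartial R (2 * (j + d) + 1) *
      (eulerPartialInv R d * eulerPartialInv R (2 * j + d + 2))) := by
  rcases d with _ | d
  · rw [tripleCoeff_of_lt (by omega)]
    simp
  · rw [show j + (d + 1) = j + 1 + d by ring, tripleCoeff_add, eulerPartialInv_eq d,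
      show (j + 1 + 1).choose 2 = (j + 1).choose 2 + j + 1 by
        rw [Nat.choose_succ_succ' (j + 1) 1, Nat.choose_one_right]; ring,
      show 2 * (j + 1) + d + 1 = 2 * j + (d + 1) + 2 by ring]
    ring

lemma tripleCoeff_self (N : ℕ) : tripleCoeff R N N = (-1) ^ N * X ^ (N + 1).choose 2 := by
  have h := tripleCoeff_add (R := R) 0 N
  rw [add_zero, add_zero] at h
  have h0 : eulerPartialInv R 0 = 1 := by
    simpa [eulerPartial] using eulerPartial_mul_inv (R := R) 0
  linear_combination h + (-1) ^ N * X ^ (N + 1).choose 2 *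
    eulerPartial_mul_inv (R := R) (2 * N + 1) + (-1) ^ N * X ^ (N + 1).choose 2 *
      eulerPartial R (2 * N + 1) * eulerPartialInv R (2 * N + 1) * h0

lemma tripleCoeff_succ_zero (N : ℕ) :
    tripleCoeff R (N + 1) 0 = (1 + (X ^ (N + 1)) ^ 2 + X ^ (N + 1)) * tripleCoeff R N 0 -
      X ^ (N + 1) * tripleCoeff R N 1 := by
  have h1 := tripleCoeff_add (R := R) (N + 1) 0
  have h2 := tripleCoeff_add (R := R) N 0
  have h3 := tripleCoeff_add_succ (R := R) N 0
  simp only [zero_add, mul_zero, pow_zero, show Nat.choose 1 2 = 0 from rfl, one_mul] at h1 h2 h3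
  rw [h1, h2, h3, show 2 * (N + 1) + 1 = 2 * N + 1 + 1 + 1 by ring, eulerPartial_succ,
    eulerPartial_succ, eulerPartialInv_eq N, eulerPartialInv_eq (N + 1)]
  ring

lemma tripleCoeff_succ_succ (N j : ℕ) :
    tripleCoeff R (N + 1) (j + 1) = (1 + (X ^ (N + 1)) ^ 2) * tripleCoeff R N (j + 1) -
      X ^ (N + 1) * (tripleCoeff R N j + tripleCoeff R N (j + 2)) := by
  rcases lt_trichotomy N j with h | rfl | h
  · simp [tripleCoeff_of_lt, h, h.trans (Nat.lt_succ_self _), show N < j + 2 by omega]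
  · rw [tripleCoeff_self, tripleCoeff_self, tripleCoeff_of_lt (by omega),
      tripleCoeff_of_lt (by omega), Nat.choose_succ_succ' (N + 1) 1, Nat.choose_one_right]
    ring
  · obtain ⟨d, rfl⟩ := Nat.exists_eq_add_of_le (show j + 1 ≤ N by omega)
    rw [show j + 1 + d + 1 = j + 1 + (d + 1) by ring, tripleCoeff_add (d + 1) (j + 1),
      tripleCoeff_add d (j + 1), tripleCoeff_add_succ d (j + 1),
      show j + 1 + d = j + (d + 1) by ring, tripleCoeff_add (d + 1) j,
      Nat.choose_succ_succ' (j + 1) 1, Nat.choose_one_right,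
      show 2 * (j + 1 + (d + 1)) + 1 = 2 * (j + (d + 1)) + 1 + 1 + 1 by ring, eulerPartial_succ,
      eulerPartial_succ, eulerPartialInv_eq d,
      show 2 * (j + 1) + (d + 1) + 1 = 2 * j + d + 4 by ring,
      show 2 * (j + 1) + d + 1 = 2 * j + d + 3 by ring,
      show 2 * (j + 1) + d + 2 = 2 * j + d + 4 by ring,
      show 2 * j + (d + 1) + 1 = 2 * j + d + 2 by ring, eulerPartialInv_eq (2 * j + d + 2),
      eulerPartialInv_eq (2 * j + d + 3)]
    ring

/-- The finite form of Jacobi's triple product. -/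
lemma prod_eq_sum_tripleCoeff (N : ℕ) :
    ∏ i ∈ range N, (Polynomial.C ((1 - X ^ (i + 1)) ^ 2) +
        Polynomial.C (X ^ (i + 1)) * Polynomial.X) =
      ∑ j ∈ range (N + 1), Polynomial.C (tripleCoeff R N j) * macMahonPoly R⟦X⟧ j := by
  induction N with
  | zero => simp [macMahonPoly, tripleCoeff_self]
  | succ N ih =>
    rw [prod_range_succ, ih, mul_comm, mul_sum_macMahonPoly _ (tripleCoeff R N)
      (tripleCoeff R (N + 1)) (tripleCoeff_succ_zero N) (tripleCoeff_succ_succ N),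
      sum_range_succ _ (N + 1), tripleCoeff_succ_succ, tripleCoeff_of_lt (Nat.lt_succ_self N),
      tripleCoeff_of_lt (show N < N + 2 by omega)]
    simp only [map_sub, map_mul, map_add, map_zero]
    ring

end TripleProduct

section MacMahon

open PowerSeries

variable {R : Type*} [CommRing R]

variable (R) in
/-- The power series `X ^ k / (1 - X ^ k) ^ 2`. -/
noncomputable def weightSeries (k : ℕ) : R⟦X⟧ :=
  PowerSeries.mk fun n ↦ if k ∣ n then ((n / k : ℕ) : R) else 0

lemma one_sub_sq_mul_weightSeries {k : ℕ} (hk : k ≠ 0) :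
    (1 - X ^ k) ^ 2 * weightSeries R k = X ^ k := by
  suffices h : (1 - X ^ k) * weightSeries R k = multiplesSeries R k by
    rw [pow_two, mul_assoc, h, one_sub_mul_multiplesSeries hk]
  ext n
  rw [sub_mul, one_mul, map_sub, coeff_X_pow_mul']
  simp only [weightSeries, multiplesSeries, coeff_mk]
  rcases lt_or_ge n k with h | h
  · rw [if_neg (by omega : ¬ k ≤ n), sub_zero, Nat.div_eq_of_lt h]
    have : ¬ (k ∣ n ∧ n ≠ 0) := fun ⟨h1, h2⟩ ↦ h2 (Nat.eq_zero_of_dvd_of_lt h1 h)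
    simp [if_neg this]
  · obtain ⟨m, rfl⟩ := Nat.exists_eq_add_of_le h
    have : (k + m) / k = m / k + 1 := by
      rw [add_comm, Nat.add_div_right _ (Nat.pos_of_ne_zero hk)]
    by_cases hd : k ∣ m <;> simp [hd, hk, this]

lemma dvd_weightSeries (k : ℕ) : X ^ k ∣ weightSeries R k := by
  rw [X_pow_dvd_iff]
  intro m hm
  simp [weightSeries, Nat.div_eq_of_lt hm]

lemma dvd_weightSeries_sub {k : ℕ} (hk : k ≠ 0) (n : ℕ) :
    X ^ (n + 1) ∣ weightSeries R k - ∑ s : Fin (n + 1), ((s : ℕ) : R⟦X⟧) * X ^ ((s : ℕ) * k) := by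
  rw [X_pow_dvd_iff]
  intro m hm
  rw [map_sub, map_sum, sub_eq_zero]
  simp only [← map_natCast (C : R →+* R⟦X⟧), coeff_C_mul, weightSeries, coeff_mk, coeff_X_pow]
  split_ifs with h
  · obtain ⟨s, rfl⟩ := h
    have hs : s < n + 1 := lt_of_le_of_lt (Nat.le_mul_of_pos_left s (Nat.pos_of_ne_zero hk)) hm
    rw [Nat.mul_div_cancel_left _ (Nat.pos_of_ne_zero hk), sum_eq_single ⟨s, hs⟩]
    · simp [mul_comm]
    · intro b _ hb
      have : k * s ≠ b * k := fun h ↦ hb (Fin.ext (by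
        rw [mul_comm] at h
        exact (Nat.eq_of_mul_eq_mul_right (Nat.pos_of_ne_zero hk) h).symm))
      simp [this]
    · simp
  · refine (sum_eq_zero fun s _ ↦ ?_).symm
    rw [if_neg, mul_zero]
    rintro rfl
    exact h (dvd_mul_left _ _)

lemma coeff_prod_weightSeries {a : ℕ} (n : ℕ) (k : Fin a → ℕ) (hk : ∀ i, k i ≠ 0) :
    coeff n (∏ i, weightSeries R (k i)) =
      ∑ s : Fin a → Fin (n + 1), if ∑ i, (s i : ℕ) * k i = n then ∏ i, ((s i : ℕ) : R) else 0 := by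
  have hmod : X ^ (n + 1) ∣ ∏ i, weightSeries R (k i) -
      ∏ i, ∑ s : Fin (n + 1), ((s : ℕ) : R⟦X⟧) * X ^ ((s : ℕ) * k i) := by
    rw [← Ideal.mem_span_singleton, ← Ideal.Quotient.eq, map_prod, map_prod]
    refine prod_congr rfl fun i _ ↦ ?_
    rw [Ideal.Quotient.eq, Ideal.mem_span_singleton]
    exact dvd_weightSeries_sub (hk i) n
  have := X_pow_dvd_iff.mp hmod n (by omega)
  rw [map_sub, sub_eq_zero] at this
  rw [this, prod_univ_sum, map_sum, Fintype.piFinset_univ]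
  refine sum_congr rfl fun s _ ↦ ?_
  rw [prod_mul_distrib, prod_pow_eq_pow_sum, ← Nat.cast_prod, ← map_natCast (C : R →+* R⟦X⟧),
    coeff_C_mul, coeff_X_pow, Nat.cast_prod]
  simp [eq_comm]

lemma sum_strictMono_prod {S : Type*} [CommSemiring S] (a n : ℕ) (L : ℕ → S) :
    ∑ g : Fin a → Fin (n + 1) with (∀ i, 0 < (g i : ℕ)) ∧ StrictMono g, ∏ i, L (g i) =
      ∑ t ∈ powersetCard a (range n), ∏ i ∈ t, L (i + 1) := by
  have hinj {g : Fin a → Fin (n + 1)} (h0 : ∀ i, 0 < (g i : ℕ)) (hg : StrictMono g) :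
      StrictMono fun i ↦ (g i : ℕ) - 1 := by
    intro i j hij
    have h1 : (g i : ℕ) < g j := hg hij
    have h2 := h0 i
    change (g i : ℕ) - 1 < g j - 1
    omega
  refine sum_bij (fun g _ ↦ univ.image fun i ↦ (g i : ℕ) - 1) ?_ ?_ ?_ ?_
  · intro g hg
    obtain ⟨h0, hg⟩ := (mem_filter.mp hg).2
    rw [mem_powersetCard, card_image_of_injective _ (hinj h0 hg).injective]
    refine ⟨?_, by simp⟩
    intro x hx
    obtain ⟨i, _, rfl⟩ := mem_image.mp hx
    have := (g i).isLt
    have := h0 i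
    rw [mem_range]
    omega
  · intro g hg g' hg' h
    obtain ⟨h0, hg⟩ := (mem_filter.mp hg).2
    obtain ⟨h0', hg'⟩ := (mem_filter.mp hg').2
    have := ((hinj h0 hg).range_inj (hinj h0' hg')).mp (by simpa [← Finset.coe_inj] using h)
    ext i
    have h1 : (g i : ℕ) - 1 = g' i - 1 := congrFun this i
    have h2 := h0 i
    have h3 := h0' i
    omega
  · intro t ht
    obtain ⟨ht, hc⟩ := mem_powersetCard.mp ht
    have hmem (i : Fin a) : t.orderEmbOfFin hc i < n := mem_range.mp (ht (t.orderEmbOfFin_mem hc i))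
    refine ⟨fun i ↦ ⟨t.orderEmbOfFin hc i + 1, Nat.succ_lt_succ (hmem i)⟩, ?_, ?_⟩
    · rw [mem_filter]
      refine ⟨mem_univ _, fun i ↦ Nat.succ_pos _, fun i j hij ↦ ?_⟩
      exact Nat.succ_lt_succ ((t.orderEmbOfFin hc).strictMono hij)
    · simp
  · intro g hg
    obtain ⟨h0, hg⟩ := (mem_filter.mp hg).2
    rw [prod_image fun i _ j _ h ↦ (hinj h0 hg).injective h]
    exact prod_congr rfl fun i _ ↦ by rw [Nat.sub_add_cancel (h0 i)]

lemma coeff_prod_one_add {S ι : Type*} [CommSemiring S] (s : Finset ι) (f : ι → S) (a : ℕ) :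
    (∏ i ∈ s, (1 + Polynomial.C (f i) * Polynomial.X)).coeff a =
      ∑ t ∈ powersetCard a s, ∏ i ∈ t, f i := by
  classical
  rw [prod_one_add, Polynomial.finsetSum_coeff, powersetCard_eq_filter, sum_filter]
  refine sum_congr rfl fun t _ ↦ ?_
  rw [prod_mul_distrib, prod_const, ← map_prod, Polynomial.coeff_C_mul_X_pow]
  simp [eq_comm]

variable (R) in
/-- The polynomial in MacMahon's series truncated at `k ≤ N`. -/
noncomputable def macMahonSeries (N : ℕ) : Polynomial R⟦X⟧ :=
  ∏ i ∈ range N, (1 + Polynomial.C (weightSeries R (i + 1)) * Polynomial.X)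

lemma MO_eq_coeff (a n : ℕ) : (MO a n : R) = coeff n ((macMahonSeries R n).coeff a) := by
  rw [macMahonSeries, coeff_prod_one_add, ← sum_strictMono_prod a n (weightSeries R), map_sum,
    sum_filter, MO, sum_filter, Nat.cast_sum,
    ← (Equiv.arrowProdEquivProdArrow (Fin a) (fun _ ↦ Fin (n + 1))
      (fun _ ↦ Fin (n + 1))).symm.sum_comp, Fintype.sum_prod_type]
  refine sum_congr rfl fun g _ ↦ ?_
  split_ifs with hg
  · rw [coeff_prod_weightSeries n _ fun i ↦ (hg.1 i).ne']
    refine sum_congr rfl fun s _ ↦ ?_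
    have hg' : ∀ i j, i < j → g i < g j := fun i j h ↦ hg.2 h
    by_cases hs : ∀ i, 0 < (s i : ℕ)
    · simp +contextual [Equiv.arrowProdEquivProdArrow, hg.1, hg', hs]
    · push Not at hs
      obtain ⟨i, hi⟩ := hs
      have h0 : ∏ i, (s i : ℕ) = 0 := prod_eq_zero (mem_univ i) (by omega)
      have h0' : ∏ i, ((s i : ℕ) : R) = 0 := by rw [← Nat.cast_prod, h0, Nat.cast_zero]
      simp [Equiv.arrowProdEquivProdArrow, h0, h0']
  · refine sum_eq_zero fun s _ ↦ ?_
    rw [if_neg, Nat.cast_zero]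
    exact fun h ↦ hg ⟨fun i ↦ (h.1 i).1, fun i j hij ↦ h.2.1 i j hij⟩

lemma coeff_macMahonSeries (a n k : ℕ) :
    coeff n ((macMahonSeries R (n + k)).coeff a) = coeff n ((macMahonSeries R n).coeff a) := by
  induction k generalizing a with
  | zero => rfl
  | succ k ih =>
    rw [← add_assoc, macMahonSeries, prod_range_succ, ← macMahonSeries, mul_add, mul_one,
      Polynomial.coeff_add, map_add, ih, add_eq_left, mul_comm, mul_assoc, Polynomial.coeff_C_mul]
    exact X_pow_dvd_iff.mp ((dvd_weightSeries (n + k + 1)).mul_right _) n (by omega)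

lemma eulerPartial_sq_mul_macMahonSeries (N a : ℕ) :
    eulerPartial R N ^ 2 * (macMahonSeries R N).coeff a =
      ∑ j ∈ range (N + 1), tripleCoeff R N j * (macMahonPoly R⟦X⟧ j).coeff a := by
  have h : Polynomial.C (eulerPartial R N ^ 2) * macMahonSeries R N =
      ∑ j ∈ range (N + 1), Polynomial.C (tripleCoeff R N j) * macMahonPoly R⟦X⟧ j := by
    rw [← prod_eq_sum_tripleCoeff, eulerPartial, macMahonSeries, ← prod_pow, map_prod,
      ← prod_mul_distrib]
    refine prod_congr rfl fun i _ ↦ ?_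
    have := congrArg Polynomial.C (one_sub_sq_mul_weightSeries (R := R) i.add_one_ne_zero)
    rw [map_mul] at this
    linear_combination Polynomial.X * this
  simpa only [Polynomial.finsetSum_coeff, Polynomial.coeff_C_mul] using
    congrArg (Polynomial.coeff · a) h

lemma dvd_eulerSeries_mul_tripleCoeff_sub (n j : ℕ) :
    X ^ (n + 1) ∣ eulerSeries R * tripleCoeff R (2 * n) j - (-1) ^ j * X ^ (j + 1).choose 2 := by
  rw [tripleCoeff]
  rcases le_or_gt j n with h | h
  · rw [if_pos (by omega)]
    have h1 := dvd_eulerSeries_sub (R := R) (show n ≤ 2 * (2 * n) + 1 by omega)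
    have h2 := dvd_eulerSeries_sub (R := R) (show n ≤ 2 * n - j by omega)
    have h3 := dvd_eulerSeries_sub (R := R) (show n ≤ 2 * n + j + 1 by omega)
    have i2 := eulerPartial_mul_inv (R := R) (2 * n - j)
    have i3 := eulerPartial_mul_inv (R := R) (2 * n + j + 1)
    have := (((h2.mul_right (eulerPartial R (2 * (2 * n) + 1))).add
      ((h3.sub h1).mul_left (eulerPartial R (2 * n - j)))).mul_left
      (eulerPartialInv R (2 * n - j) * eulerPartialInv R (2 * n + j + 1))).mul_left
      ((-1) ^ j * X ^ (j + 1).choose 2)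
    convert this using 1
    linear_combination (-1) ^ j * X ^ (j + 1).choose 2 * (i2 + eulerPartial R (2 * n - j) *
      eulerPartialInv R (2 * n - j) * i3)
  · have hX : (X : R⟦X⟧) ^ (n + 1) ∣ X ^ (j + 1).choose 2 := by
      refine pow_dvd_pow _ ?_
      rw [Nat.choose_succ_succ' j 1, Nat.choose_one_right]
      omega
    refine dvd_sub ?_ (hX.mul_left _)
    split_ifs
    · exact (((hX.mul_left _).mul_right _).mul_right _).mul_left _
    · simp

end MacMahon

section Congruence

open PowerSeries

lemma choose_modEq_zero {k : ℕ} (m : ℕ) (hk : k % 17 ≠ 16) :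
    k.choose (2 * (17 * m + 16) + 1) ≡ 0 [MOD 17] := by
  refine Choose.choose_modEq_choose_mod_mul_choose_div_nat.trans ?_
  rw [show (2 * (17 * m + 16) + 1) % 17 = 16 by omega, Nat.choose_eq_zero_of_lt (by omega),
    zero_mul]

lemma theta_X_pow_mul_coeff_macMahonPoly (m j : ℕ) :
    theta (ZMod 17) ((-1) ^ j * X ^ (j + 1).choose 2 *
      (macMahonPoly (ZMod 17)⟦X⟧ j).coeff (17 * m + 16)) = 0 := by
  rw [coeff_macMahonPoly]
  generalize hb : (j + (17 * m + 16) + 1).choose _ + (j + (17 * m + 16)).choose _ = b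
  by_cases hj : 17 ∣ (j + 1).choose 2
  · have hneg (i : ℕ) : theta (ZMod 17) ((-1) ^ i) = 0 := by
      simp [Derivation.leibniz_pow]
    have hX : theta (ZMod 17) (X ^ (j + 1).choose 2) = 0 := by
      rw [theta_X_pow, ← map_natCast (C : ZMod 17 →+* (ZMod 17)⟦X⟧),
        (ZMod.natCast_eq_zero_iff _ _).mpr hj, map_zero, zero_mul]
    simp only [Derivation.leibniz, hneg, hX, Derivation.map_natCast, smul_zero, add_zero]
  · have hc := Nat.add_one_mul_choose_eq j 1
    rw [Nat.choose_one_right] at hc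
    have h17 : Nat.Coprime 17 2 := by norm_num
    have h0 : ¬ 17 ∣ j := fun h ↦ hj (h17.dvd_of_dvd_mul_right (hc ▸ h.mul_left _))
    have h1 : ¬ 17 ∣ j + 1 := fun h ↦ hj (h17.dvd_of_dvd_mul_right (hc ▸ h.mul_right _))
    have h := (choose_modEq_zero m (k := j + (17 * m + 16) + 1) (by omega)).add
      (choose_modEq_zero m (k := j + (17 * m + 16)) (by omega))
    rw [hb, add_zero, Nat.modEq_zero_iff_dvd, ← ZMod.natCast_eq_zero_iff] at h
    rw [← map_natCast (C : ZMod 17 →+* (ZMod 17)⟦X⟧), h, map_zero, mul_zero, mul_zero, map_zero]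

lemma coeff_macMahonSeries_eq_zero (n m : ℕ) :
    coeff (17 * n + 15) ((macMahonSeries (ZMod 17) (2 * (17 * n + 15))).coeff (17 * m + 16)) =
      0 := by
  set N := 17 * n + 15
  set e := (macMahonSeries (ZMod 17) (2 * N)).coeff (17 * m + 16) with he
  set E := eulerSeries (ZMod 17) with hE
  set H := ∑ j ∈ range (2 * N + 1), (-1) ^ j * X ^ (j + 1).choose 2 *
    (macMahonPoly (ZMod 17)⟦X⟧ j).coeff (17 * m + 16) with hH
  have hθ : theta (ZMod 17) H = 0 := by
    rw [hH, map_sum]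
    exact sum_eq_zero fun j _ ↦ theta_X_pow_mul_coeff_macMahonPoly m j
  have hdvd : X ^ (N + 1) ∣ E ^ 3 * e - H := by
    have h1 : X ^ (N + 1) ∣ E * (eulerPartial (ZMod 17) (2 * N) ^ 2 * e) - H := by
      rw [he, eulerPartial_sq_mul_macMahonSeries, mul_sum, hH, ← sum_sub_distrib]
      refine dvd_sum fun j _ ↦ ?_
      rw [← mul_assoc, ← sub_mul]
      exact (dvd_eulerSeries_mul_tripleCoeff_sub N j).mul_right _
    have h2 := dvd_eulerSeries_sub (R := ZMod 17) (show N ≤ 2 * N by omega)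
    convert (h2.mul_right ((E + eulerPartial (ZMod 17) (2 * N)) * E * e)).add h1 using 1
    ring
  obtain ⟨V, hV⟩ : ∃ V, E * V = 1 :=
    ⟨invOfUnit E 1, mul_invOfUnit E 1 (constantCoeff_eulerSeries (R := ZMod 17))⟩
  obtain ⟨G, hG⟩ := exists_theta_eq
  have hVθ : theta (ZMod 17) (V ^ 51) = 0 := by
    rw [Derivation.leibniz_pow, nsmul_eq_mul, Nat.cast_ofNat,
      show (OfNat.ofNat 51 : (ZMod 17)⟦X⟧) = 3 * 17 by norm_num, seventeen_eq_zero]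
    simp
  have hGθ : theta (ZMod 17) (G * (H * V ^ 51)) = X ^ 2 * E ^ 48 * H * V ^ 51 := by
    rw [Derivation.leibniz, Derivation.leibniz, hθ, hVθ, hG]
    simp only [smul_eq_mul]
    ring
  have hdvd' : X ^ (N + 3) ∣ X ^ 2 * e - theta (ZMod 17) (G * (H * V ^ 51)) := by
    have hV51 : E ^ 51 * V ^ 51 = 1 := by rw [← mul_pow, hV, one_pow]
    have h3 := (mul_dvd_mul_left (X ^ 2) hdvd).mul_right (E ^ 48 * V ^ 51)
    rw [← pow_add, show 2 + (N + 1) = N + 3 by ring] at h3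
    rw [hGθ]
    convert h3 using 1
    linear_combination -X ^ 2 * e * hV51
  have := X_pow_dvd_iff.mp hdvd' (N + 2) (by omega)
  rw [map_sub, coeff_theta, (ZMod.natCast_eq_zero_iff (N + 2) 17).mpr (by omega), zero_mul,
    sub_zero, coeff_X_pow_mul] at this
  exact this

end Congruence

/-- for all non-negative integers `n` and `m`,
`MO (17m+16; 17n+15) ≡ 0 (mod 17)`. -/
theorem MO_mod_seventeen (n m : ℕ) :
    17 ∣ MO (17 * m + 16) (17 * n + 15) := by
  rw [← ZMod.natCast_eq_zero_iff, MO_eq_coeff, ← coeff_macMahonSeries _ _ (17 * n + 15), ← two_mul]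
  exact coeff_macMahonSeries_eq_zero n m
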